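/- (Proposition 1 of the paper, abstract form: the set of strings an agent can generate depends only on its local state.) Let E and E' be two encryption functions (corresponding to two runs r and r' with r_i(m) = r'_i(m'), so that the base sets of strings coincide), and let B ⊆ Str be a common base set. Assume the coherence conditions: (a) for all s ∈ Str and k ∈ K, if E s k ∈ C_E(B) and inv k ∈ C_E(B), then E s k = E' s k; (b) for all s ∈ Str and k ∈ K, if s ∈ C_E(B) and k ∈ C_E(B), then E s k = E' s k; and the symmetric conditions obtained by exchanging the roles of E and E' (and of C_E(B) and C_{E'}(B)). Then C_E(B) = C_{E'}(B). -/

import Mathlib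

/-- A set `S` of strings is Dolev–Yao closed for encryption function `E` and base set `B`. -/
def DYClosed {Str : Type*} (K : Set Str) (inv : Str → Str) (pr : Str → Str → Str)
    (E : Str → Str → Str) (B : Set Str) (S : Set Str) : Prop :=
  B ⊆ S ∧
  (∀ s s', pr s s' ∈ S ↔ s ∈ S ∧ s' ∈ S) ∧
  (∀ s k, k ∈ K → E s k ∈ S → inv k ∈ S → s ∈ S) ∧
  (∀ s k, k ∈ K → s ∈ S → k ∈ S → E s k ∈ S)

/-- The Dolev–Yao closure of a base set `B`: the intersection of all Dolev–Yao closed sets. -/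
def DYClosure {Str : Type*} (K : Set Str) (inv : Str → Str) (pr : Str → Str → Str)
    (E : Str → Str → Str) (B : Set Str) : Set Str :=
  ⋂₀ {S | DYClosed K inv pr E B S}

theorem dyClosed_dyClosure {Str : Type*} (K : Set Str) (inv : Str → Str)
    (pr : Str → Str → Str) (E : Str → Str → Str) (B : Set Str) :
    DYClosed K inv pr E B (DYClosure K inv pr E B) := by
  refine ⟨fun s hs S hS => hS.1 hs, fun s s' => ⟨fun h => ⟨?_, ?_⟩, ?_⟩, ?_, ?_⟩
  · exact fun S hS => ((hS.2.1 s s').1 (h S hS)).1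
  · exact fun S hS => ((hS.2.1 s s').1 (h S hS)).2
  · exact fun h S hS => (hS.2.1 s s').2 ⟨h.1 S hS, h.2 S hS⟩
  · exact fun s k hk h hi S hS => hS.2.2.1 s k hk (h S hS) (hi S hS)
  · exact fun s k hk h hi S hS => hS.2.2.2 s k hk (h S hS) (hi S hS)

/-- If `E` agrees with `E'` wherever the closure for `E` can decrypt or encrypt, then the closure
for `E` is contained in the closure for `E'`. -/
theorem dyClosure_subset_of_coherent {Str : Type*} (K : Set Str) (inv : Str → Str)
    (pr : Str → Str → Str) (E E' : Str → Str → Str) (B : Set Str)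
    (ha : ∀ s k, k ∈ K → E s k ∈ DYClosure K inv pr E B →
        inv k ∈ DYClosure K inv pr E B → E s k = E' s k)
    (hb : ∀ s k, k ∈ K → s ∈ DYClosure K inv pr E B →
        k ∈ DYClosure K inv pr E B → E s k = E' s k) :
    DYClosure K inv pr E B ⊆ DYClosure K inv pr E' B := by
  obtain ⟨base, pair, dec, enc⟩ := dyClosed_dyClosure K inv pr E B
  obtain ⟨base', pair', dec', enc'⟩ := dyClosed_dyClosure K inv pr E' B
  have closed_inter :
      DYClosed K inv pr E B (DYClosure K inv pr E B ∩ DYClosure K inv pr E' B) := by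
    refine ⟨Set.subset_inter base base', fun s s' => ?_, ?_, ?_⟩
    · simp only [Set.mem_inter_iff, pair, pair']
      tauto
    · rintro s k hk ⟨he, he'⟩ ⟨hi, hi'⟩
      exact ⟨dec s k hk he hi, dec' s k hk (ha s k hk he hi ▸ he') hi'⟩
    · rintro s k hk ⟨hs, hs'⟩ ⟨hk₁, hk₂⟩
      exact ⟨enc s k hk hs hk₁, (hb s k hk hs hk₁).symm ▸ enc' s k hk hs' hk₂⟩
  exact fun s hs => (hs _ closed_inter).2

/-- Proposition 1 (abstract form): under the coherence conditions linking two encryption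
functions `E` and `E'` on the respective closures, the Dolev–Yao closures coincide. -/
theorem dyClosure_eq_of_coherent {Str : Type*} (K : Set Str) (inv : Str → Str)
    (pr : Str → Str → Str) (E E' : Str → Str → Str) (B : Set Str)
    (ha : ∀ s k, k ∈ K → E s k ∈ DYClosure K inv pr E B →
        inv k ∈ DYClosure K inv pr E B → E s k = E' s k)
    (hb : ∀ s k, k ∈ K → s ∈ DYClosure K inv pr E B →
        k ∈ DYClosure K inv pr E B → E s k = E' s k)
    (ha' : ∀ s k, k ∈ K → E' s k ∈ DYClosure K inv pr E' B →
        inv k ∈ DYClosure K inv pr E' B → E' s k = E s k)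
    (hb' : ∀ s k, k ∈ K → s ∈ DYClosure K inv pr E' B →
        k ∈ DYClosure K inv pr E' B → E' s k = E s k) :
    DYClosure K inv pr E B = DYClosure K inv pr E' B := by
  exact Set.Subset.antisymm (dyClosure_subset_of_coherent K inv pr E E' B ha hb)
    (dyClosure_subset_of_coherent K inv pr E' E B ha' hb')
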